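/- arXiv:2007.04384 — 2 statements merged into one kernel-verified Lean document; each statement's English description precedes it below -/
import Mathlib

section
/- (Lavrentieff) If X and Y are complete metric spaces and h is a homeomorphism of a subset A ⊆ X onto a subset B ⊆ Y (with subspace topologies), then h can be extended to a homeomorphism h* of A* onto B*, where A* is a Gδ set in X with A ⊆ A* ⊆ closure(A) and B* is a Gδ set in Y with B ⊆ B* ⊆ closure(B). -/
open Filter Topology Metric

/-- The points `x` and `y` are limits, along `u` and `v` respectively, of one and the same
proper filter: the trace of the neighborhoods of `x` equals that of the neighborhoods of `y`. -/
def SameTrace {ι X Y : Type*} [TopologicalSpace X] [TopologicalSpace Y] (u : ι → X) (v : ι → Y)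
    (x : X) (y : Y) : Prop :=
  (comap u (𝓝 x)).NeBot ∧ comap u (𝓝 x) = comap v (𝓝 y)

namespace SameTrace

section Topological

variable {ι X Y : Type*} [TopologicalSpace X] [TopologicalSpace Y] {u : ι → X} {v : ι → Y}
  {x : X} {y : Y}

theorem symm (h : SameTrace u v x y) : SameTrace v u y x :=
  ⟨h.2 ▸ h.1, h.2.symm⟩

theorem tendsto_right (h : SameTrace u v x y) : Tendsto v (comap u (𝓝 x)) (𝓝 y) :=
  h.2 ▸ tendsto_comap

theorem unique_right [T2Space Y] {y' : Y} (h : SameTrace u v x y) (h' : SameTrace u v x y') :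
    y = y' :=
  have := h.1
  tendsto_nhds_unique h.tendsto_right h'.tendsto_right

theorem mem_closure_range (h : SameTrace u v x y) : x ∈ closure (Set.range u) :=
  have := h.1
  mem_closure_of_tendsto tendsto_comap (Eventually.of_forall Set.mem_range_self)

theorem of_isInducing [TopologicalSpace ι] (hu : IsInducing u) (hv : IsInducing v) (i : ι) :
    SameTrace u v (u i) (v i) := by
  rw [SameTrace, ← hu.nhds_eq_comap, ← hv.nhds_eq_comap]
  exact ⟨inferInstance, rfl⟩

theorem continuous_of_forall [RegularSpace Y] {A : Set X} {f : A → Y}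
    (hf : ∀ a : A, SameTrace u v a (f a)) : Continuous f := by
  refine continuous_iff_continuousAt.2 fun a => ?_
  refine (closed_nhds_basis (f a)).tendsto_right_iff.2 fun V hV => ?_
  have hmem : v ⁻¹' V ∈ comap u (𝓝 (a : X)) := (hf a).tendsto_right hV.1
  obtain ⟨U, hU, hUV⟩ := mem_comap.1 hmem
  filter_upwards [continuous_subtype_val.continuousAt (eventually_mem_nhds_iff.2 hU)] with b hb
  have := (hf b).1
  exact hV.2.mem_of_tendsto (hf b).tendsto_right (mem_of_superset (preimage_mem_comap hb) hUV)

variable (u v) in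
/-- The relation `SameTrace u v` is the graph of a homeomorphism from its domain
onto its range. -/
theorem exists_homeomorph [T3Space X] [T3Space Y] :
    ∃ e : {x | ∃ y, SameTrace u v x y} ≃ₜ {y | ∃ x, SameTrace u v x y},
      ∀ a : {x | ∃ y, SameTrace u v x y}, SameTrace u v a (e a) := by
  choose f hf using fun a : {x | ∃ y, SameTrace u v x y} => a.2
  choose g hg using fun b : {y | ∃ x, SameTrace u v x y} => b.2
  exact ⟨{
    toFun := fun a => ⟨f a, a, hf a⟩
    invFun := fun b => ⟨g b, b, hg b⟩
    left_inv := fun a => Subtype.ext ((hg _).symm.unique_right (hf a).symm)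
    right_inv := fun b => Subtype.ext ((hf _).unique_right (hg b))
    continuous_toFun := (continuous_of_forall hf).subtype_mk _
    continuous_invFun := (continuous_of_forall fun b => (hg b).symm).subtype_mk _ }, hf⟩

end Topological

section Metric

variable {ι X Y : Type*} [MetricSpace X] [MetricSpace Y]

/-- The points `x` near which `v` is confined to a ball of radius less than `ε`
such that `u` varies by at most `ε` on the preimage of the concentric ball of twice the radius. -/
def controlledSet (u : ι → X) (v : ι → Y) (ε : ℝ) : Set X :=
  {x | ∃ (y : Y) (δ : ℝ), 0 < δ ∧ δ < ε ∧ v ⁻¹' ball y δ ∈ comap u (𝓝 x) ∧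
    ∀ i j, v i ∈ ball y (2 * δ) → v j ∈ ball y (2 * δ) → dist (u i) (u j) ≤ ε}

theorem isOpen_controlledSet (u : ι → X) (v : ι → Y) (ε : ℝ) :
    IsOpen (controlledSet u v ε) := by
  refine isOpen_iff_mem_nhds.2 ?_
  rintro x ⟨y, δ, hδ, hδε, hmem, hu⟩
  obtain ⟨U, hU, hUV⟩ := mem_comap.1 hmem
  filter_upwards [eventually_mem_nhds_iff.2 hU] with x' hx'
  exact ⟨y, δ, hδ, hδε, mem_of_superset (preimage_mem_comap hx') hUV, hu⟩

theorem mem_controlledSet {u : ι → X} {v : ι → Y} {x : X} {y : Y} (h : SameTrace u v x y)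
    {ε : ℝ} (hε : 0 < ε) : x ∈ controlledSet u v ε := by
  obtain ⟨r, hr, hrx⟩ := (nhds_basis_ball.comap v).mem_iff.1
    (h.symm.tendsto_right (ball_mem_nhds x (half_pos hε)))
  have hle : 2 * min (r / 2) (ε / 2) ≤ r := by linarith [min_le_left (r / 2) (ε / 2)]
  have hpos : 0 < min (r / 2) (ε / 2) := lt_min (half_pos hr) (half_pos hε)
  refine ⟨y, min (r / 2) (ε / 2), hpos, (min_le_right _ _).trans_lt (half_lt_self hε),
    h.tendsto_right (ball_mem_nhds y hpos), fun i j hi hj => ?_⟩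
  have hi' : dist (u i) x < ε / 2 := hrx (ball_subset_ball hle hi)
  have hj' : dist (u j) x < ε / 2 := hrx (ball_subset_ball hle hj)
  linarith [dist_triangle_right (u i) (u j) x]

theorem exists_of_mem_controlledSet [CompleteSpace Y] {u : ι → X} {v : ι → Y} {x : X}
    (hx : x ∈ closure (Set.range u)) (h : ∀ ε > 0, x ∈ controlledSet u v ε) :
    ∃ y, SameTrace u v x y := by
  have hne : (comap u (𝓝 x)).NeBot := comap_neBot_iff.2 fun t ht => by
    obtain ⟨_, hz, i, rfl⟩ := mem_closure_iff_nhds.1 hx t ht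
    exact ⟨i, hz⟩
  have hcauchy : Cauchy (map v (comap u (𝓝 x))) := by
    refine Metric.cauchy_iff.2 ⟨hne.map v, fun ε hε => ?_⟩
    obtain ⟨y, δ, -, hδε, hmem, -⟩ := h (ε / 2) (half_pos hε)
    refine ⟨ball y δ, hmem, fun a ha b hb => ?_⟩
    linarith [dist_triangle_right a b y, mem_ball.1 ha, mem_ball.1 hb]
  obtain ⟨z, hz⟩ := CompleteSpace.complete hcauchy
  have hvz : Tendsto v (comap u (𝓝 x)) (𝓝 z) := hz
  refine ⟨z, hne, le_antisymm hvz.le_comap ?_⟩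
  refine Tendsto.le_comap (Metric.nhds_basis_ball.tendsto_right_iff.2 fun ε hε => ?_)
  obtain ⟨y, δ, hδ, -, hmem, hu⟩ := h (ε / 2) (half_pos hε)
  have hzy : z ∈ ball y (2 * δ) :=
    closedBall_subset_ball (by linarith) (isClosed_closedBall.mem_of_tendsto hvz
      (mem_of_superset hmem (Set.preimage_mono ball_subset_closedBall)))
  filter_upwards [preimage_mem_comap (isOpen_ball.mem_nhds hzy)] with i hi
  have hle : dist (u i) x ≤ ε / 2 :=
    le_of_tendsto (tendsto_const_nhds.dist tendsto_comap) <| mem_of_superset hmem fun j hj =>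
      hu i j hi (ball_subset_ball (by linarith) hj)
  exact mem_ball.2 (by linarith)

theorem isGδ_domain [CompleteSpace Y] (u : ι → X) (v : ι → Y) :
    IsGδ {x | ∃ y, SameTrace u v x y} := by
  have heq : {x | ∃ y, SameTrace u v x y} =
      closure (Set.range u) ∩ ⋂ n : ℕ, controlledSet u v (1 / (n + 1)) := by
    ext x
    refine ⟨fun ⟨y, hy⟩ => ⟨hy.mem_closure_range, Set.mem_iInter.2 fun n =>
      hy.mem_controlledSet Nat.one_div_pos_of_nat⟩, fun ⟨hx, hx'⟩ => ?_⟩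
    refine exists_of_mem_controlledSet hx fun ε hε => ?_
    obtain ⟨n, hn⟩ := exists_nat_one_div_lt hε
    obtain ⟨y, δ, hδ, hδn, hmem, hu⟩ := Set.mem_iInter.1 hx' n
    exact ⟨y, δ, hδ, hδn.trans hn, hmem, fun i j hi hj => (hu i j hi hj).trans hn.le⟩
  rw [heq]
  exact isClosed_closure.isGδ.inter (.iInter_of_isOpen fun _ => isOpen_controlledSet u v _)

theorem isGδ_range [CompleteSpace X] (u : ι → X) (v : ι → Y) :
    IsGδ {y | ∃ x, SameTrace u v x y} := by
  have heq : {y | ∃ x, SameTrace u v x y} = {y | ∃ x, SameTrace v u y x} :=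
    Set.ext fun _ => exists_congr fun _ => ⟨symm, symm⟩
  exact heq ▸ isGδ_domain v u

end Metric

end SameTrace

/-- Lavrentieff: a homeomorphism between subsets of complete metric spaces
extends to a homeomorphism between Gδ sets squeezed between the sets and their closures. -/
theorem lavrentieff_extension
    {X Y : Type*} [MetricSpace X] [CompleteSpace X] [MetricSpace Y] [CompleteSpace Y]
    (A : Set X) (B : Set Y) (h : A ≃ₜ B) :
    ∃ (A' : Set X) (B' : Set Y) (hAA' : A ⊆ A') (_ : B ⊆ B'),
      IsGδ A' ∧ IsGδ B' ∧ A' ⊆ closure A ∧ B' ⊆ closure B ∧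
      ∃ h' : A' ≃ₜ B', ∀ (x : X) (hx : x ∈ A),
        (h' ⟨x, hAA' hx⟩ : Y) = (h ⟨x, hx⟩ : Y) := by
  let u : A → X := Subtype.val
  let v : A → Y := fun a => h a
  have huv (a : A) : SameTrace u v a (h a) :=
    SameTrace.of_isInducing .subtypeVal (IsInducing.subtypeVal.comp h.isInducing) a
  obtain ⟨e, he⟩ := SameTrace.exists_homeomorph u v
  refine ⟨{x | ∃ y, SameTrace u v x y}, {y | ∃ x, SameTrace u v x y},
    fun x hx => ⟨_, huv ⟨x, hx⟩⟩, fun y hy => ⟨h.symm ⟨y, hy⟩, ?_⟩,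
    SameTrace.isGδ_domain u v, SameTrace.isGδ_range u v, ?_, ?_, e,
    fun x hx => (he _).unique_right (huv ⟨x, hx⟩)⟩
  · simpa using huv (h.symm ⟨y, hy⟩)
  · rintro x ⟨y, hxy⟩
    exact closure_mono (Set.range_subset_iff.2 fun a => a.2) hxy.mem_closure_range
  · rintro y ⟨x, hxy⟩
    exact closure_mono (Set.range_subset_iff.2 fun a => (h a).2) hxy.symm.mem_closure_range
end

section
/- Let (X, d_X) and (Y, d_Y) be complete metric spaces, let B_X and B_Y be bases of their topologies, let T : B_X → B_Y be a bijection such that T(U) ⊆ T(V) if and only if U ⊆ V, and define X₀ as in the context. If Z' is a metric space and φ'_X : Z' → X and φ'_Y : Z' → Y are topological embeddings such that for every z ∈ Z' and every U ∈ B_X one has φ'_X(z) ∈ U if and only if φ'_Y(z) ∈ T(U), then φ'_X(Z') ⊆ X₀; in particular φ'_X embeds Z' into X₀. -/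
/-- In a T₁ space, a point lying in every basic neighbourhood of `x` equals `x`. -/
theorem TopologicalSpace.IsTopologicalBasis.eq_of_forall_mem {α : Type*} [TopologicalSpace α]
    [T1Space α] {B : Set (Set α)} (hB : TopologicalSpace.IsTopologicalBasis B) {x y : α}
    (h : ∀ U ∈ B, x ∈ U → y ∈ U) : y = x := by
  by_contra hne
  obtain ⟨U, hU, hxU, hsub⟩ := hB.exists_subset_of_mem_open
    (show x ∈ ({y}ᶜ : Set α) from fun hxy => hne (Set.mem_singleton_iff.mp hxy).symm)
    isOpen_compl_singleton
  exact hsub (h U hU hxU) rfl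


/-- `R_X(x) = ⋂ {T U : U ∈ B_X, x ∈ U}`. -/
def RsetX {X Y : Type*} (BX : Set (Set X)) (T : Set X → Set Y) (x : X) : Set Y :=
  ⋂ U ∈ BX, ⋂ (_ : x ∈ U), T U

/-- `R_Y(y) = ⋂ {S V = T⁻¹ V : V ∈ B_Y, y ∈ V}`, where `S` is the inverse of `T`. -/
def RsetY {X Y : Type*} (BY : Set (Set Y)) (S : Set Y → Set X) (y : Y) : Set X :=
  ⋂ V ∈ BY, ⋂ (_ : y ∈ V), S V

/-- `X₀` is the set of points `x` for which `R_X(x)` is a singleton `{y}` with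
`R_Y(y) = {x}`. -/
def Xzero {X Y : Type*} (BX : Set (Set X)) (BY : Set (Set Y))
    (T : Set X → Set Y) (S : Set Y → Set X) : Set X :=
  {x | ∃ y : Y, RsetX BX T x = {y} ∧ RsetY BY S y = {x}}

/-- if a metric space `Z'` embeds into `X` and `Y` compatibly with the basis
isomorphism `T`, then the image of the embedding into `X` is contained in `X₀`. -/
theorem embedding_range_subset_Xzero
    {X Y Z' : Type*} [MetricSpace X] [CompleteSpace X] [MetricSpace Y] [CompleteSpace Y]
    [MetricSpace Z']
    (BX : Set (Set X)) (BY : Set (Set Y))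
    (hBX : TopologicalSpace.IsTopologicalBasis BX)
    (hBY : TopologicalSpace.IsTopologicalBasis BY)
    (T : Set X → Set Y) (S : Set Y → Set X)
    (hTmem : ∀ U ∈ BX, T U ∈ BY) (hSmem : ∀ V ∈ BY, S V ∈ BX)
    (hST : ∀ U ∈ BX, S (T U) = U) (hTS : ∀ V ∈ BY, T (S V) = V)
    (hTiso : ∀ U ∈ BX, ∀ V ∈ BX, (T U ⊆ T V ↔ U ⊆ V))
    (φX : Z' → X) (φY : Z' → Y)
    (hφX : Topology.IsEmbedding φX) (hφY : Topology.IsEmbedding φY)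
    (hcompat : ∀ z : Z', ∀ U ∈ BX, (φX z ∈ U ↔ φY z ∈ T U)) :
    Set.range φX ⊆ Xzero BX BY T S := by
  rintro _ ⟨z, rfl⟩
  have hcompat' : ∀ V ∈ BY, (φX z ∈ S V ↔ φY z ∈ V) := fun V hV => by
    rw [hcompat z _ (hSmem V hV), hTS V hV]
  refine ⟨φY z, Set.eq_singleton_iff_unique_mem.mpr ⟨?_, fun y hy => ?_⟩,
    Set.eq_singleton_iff_unique_mem.mpr ⟨?_, fun x hx => ?_⟩⟩
  · simp only [RsetX, Set.mem_iInter]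
    exact fun U hU hz => (hcompat z U hU).mp hz
  · simp only [RsetX, Set.mem_iInter] at hy
    refine hBY.eq_of_forall_mem fun V hV hz => ?_
    simpa only [hTS V hV] using hy (S V) (hSmem V hV) ((hcompat' V hV).mpr hz)
  · simp only [RsetY, Set.mem_iInter]
    exact fun V hV hz => (hcompat' V hV).mpr hz
  · simp only [RsetY, Set.mem_iInter] at hx
    refine hBX.eq_of_forall_mem fun U hU hz => ?_
    simpa only [hST U hU] using hx (T U) (hTmem U hU) ((hcompat z U hU).mp hz)
end
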